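/- arXiv:2307.06422 — 2 statements merged into one kernel-verified Lean document; each statement's English description precedes it below -/
import Mathlib

section
/- Let n, h, D be natural numbers with h ≥ 1, let r ∈ [n], s > 0, and α > 1. Let A, A' ∈ {0,1}^{n×n} be adjacency matrices with zero diagonal, every column of each summing to at most D, that differ only in row and column r. Let H, H' ∈ ℝ^{n×h} have every row of ℓ2 norm at most 1 with H_i = H'_i for every i ≠ r. Let N and N' be independent (n−1)×h Gaussian noise matrices with standard deviation s. Then the Rényi divergence of order α between the distribution of [AH]_{∖r} + N and the distribution of [A'H']_{∖r} + N' is at most 4Dα/(2s²) = 2Dα/s². -/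
open MeasureTheory ProbabilityTheory Finset

/-- Rényi divergence of order `a` between measures `P` and `Q` (value in `EReal`):
`D_a(P‖Q) = (1/(a−1))·log ∫ (dP/dQ)^a dQ`. -/
noncomputable def renyiDiv {Ω : Type*} [MeasurableSpace Ω] (a : ℝ)
    (P Q : Measure Ω) : EReal :=
  (((a - 1)⁻¹ : ℝ) : EReal) * ENNReal.log (∫⁻ x, (P.rnDeriv Q x) ^ a ∂Q)

/-- The law of an `I × J` matrix of i.i.d. centered Gaussian entries with standard
deviation `s`. -/
noncomputable def gaussianMatrix (I J : Type*) [Fintype I] [Fintype J] (s : ℝ) :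
    Measure (I → J → ℝ) :=
  Measure.pi fun _ : I => Measure.pi fun _ : J =>
    gaussianReal 0 ⟨s ^ 2, sq_nonneg s⟩

open scoped ENNReal NNReal

lemma gap_lintegral_pi_prod {ι : Type*} [Fintype ι] {X : ι → Type*} [∀ i, MeasurableSpace (X i)]
    (ν : ∀ i, Measure (X i)) [∀ i, IsProbabilityMeasure (ν i)]
    (g : ∀ i, X i → ℝ≥0∞) (hg : ∀ i, Measurable (g i)) :
    ∫⁻ x, ∏ i, g i (x i) ∂(Measure.pi ν) = ∏ i, ∫⁻ y, g i y ∂(ν i) := by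
  have hI : iIndepFun (fun i (ω : ∀ i, X i) => g i (ω i)) (Measure.pi ν) :=
    iIndepFun_pi fun i => (hg i).aemeasurable
  rw [lintegral_prod_eq_prod_lintegral_of_indepFun Finset.univ _ hI
    (fun i => (hg i).comp (measurable_pi_apply i))]
  refine Finset.prod_congr rfl fun i _ => ?_
  have hmp := measurePreserving_eval ν i
  exact hmp.lintegral_comp (hg i)

lemma gap_pi_withDensity {ι : Type*} [Fintype ι] {X : ι → Type*} [∀ i, MeasurableSpace (X i)]
    (μ ν : ∀ i, Measure (X i)) [∀ i, IsProbabilityMeasure (ν i)] [∀ i, IsProbabilityMeasure (μ i)]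
    (g : ∀ i, X i → ℝ≥0∞) (hg : ∀ i, Measurable (g i))
    (h : ∀ i, μ i = (ν i).withDensity (g i)) :
    Measure.pi μ = (Measure.pi ν).withDensity (fun x => ∏ i, g i (x i)) := by
  classical
  refine Measure.pi_eq fun s hs => ?_
  have hS : MeasurableSet (Set.univ.pi s) := MeasurableSet.univ_pi hs
  rw [withDensity_apply _ hS, ← lintegral_indicator hS]
  have e : (Set.univ.pi s).indicator (fun x : ∀ i, X i => ∏ i, g i (x i))
      = fun x => ∏ i, (s i).indicator (g i) (x i) := by
    funext x
    by_cases hx : x ∈ Set.univ.pi s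
    · rw [Set.indicator_of_mem hx]
      refine Finset.prod_congr rfl fun i _ => ?_
      rw [Set.indicator_of_mem (hx i (Set.mem_univ i))]
    · rw [Set.indicator_of_notMem hx]
      have : ∃ i, x i ∉ s i := by
        by_contra hc
        push Not at hc
        exact hx fun i _ => hc i
      obtain ⟨i, hi⟩ := this
      exact (Finset.prod_eq_zero (Finset.mem_univ i) (Set.indicator_of_notMem hi _)).symm
  rw [e, gap_lintegral_pi_prod ν _ (fun i => (hg i).indicator (hs i))]
  refine Finset.prod_congr rfl fun i _ => ?_
  rw [lintegral_indicator (hs i), h i, withDensity_apply _ (hs i)]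

/-- `P` has a density w.r.t. `Q` whose `a`-th moment is `exp c`. -/
def GapDens {Ω : Type*} [MeasurableSpace Ω] (a : ℝ) (P Q : Measure Ω) (c : ℝ) : Prop :=
  ∃ g : Ω → ℝ≥0∞, Measurable g ∧ P = Q.withDensity g ∧
    ∫⁻ x, g x ^ a ∂Q = ENNReal.ofReal (Real.exp c)

lemma GapDens.pi {ι : Type*} [Fintype ι] {X : ι → Type*} [∀ i, MeasurableSpace (X i)] {a : ℝ}
    (ha : 0 ≤ a)
    (μ ν : ∀ i, Measure (X i)) [∀ i, IsProbabilityMeasure (ν i)] [∀ i, IsProbabilityMeasure (μ i)]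
    (c : ι → ℝ) (h : ∀ i, GapDens a (μ i) (ν i) (c i)) :
    GapDens a (Measure.pi μ) (Measure.pi ν) (∑ i, c i) := by
  choose g hg hd hi using h
  refine ⟨fun x => ∏ i, g i (x i), ?_, gap_pi_withDensity μ ν g hg hd, ?_⟩
  · exact Finset.measurable_prod _ fun i _ => (hg i).comp (measurable_pi_apply i)
  · simp_rw [← ENNReal.prod_rpow_of_nonneg ha]
    rw [gap_lintegral_pi_prod ν (fun i y => g i y ^ a) (fun i => (hg i).pow_const a)]
    simp_rw [hi]
    rw [Real.exp_sum, ENNReal.ofReal_prod_of_nonneg fun i _ => (Real.exp_pos _).le]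

lemma GapDens.gaussian (a m m' : ℝ) (v : ℝ≥0) (hv : v ≠ 0) :
    GapDens a (gaussianReal m v) (gaussianReal m' v) (a * (a - 1) * (m - m') ^ 2 / (2 * v)) := by
  have hv' : (v : ℝ) ≠ 0 := by exact_mod_cast hv
  refine ⟨fun x => ENNReal.ofReal (Real.exp (((m - m') * x - (m ^ 2 - m' ^ 2) / 2) / v)),
    by fun_prop, ?_, ?_⟩
  · rw [gaussianReal_of_var_ne_zero _ hv, gaussianReal_of_var_ne_zero _ hv,
      ← withDensity_mul _ (measurable_gaussianPDF _ _) (by fun_prop)]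
    congr 1
    funext x
    rw [Pi.mul_apply, gaussianPDF, gaussianPDF,
      ← ENNReal.ofReal_mul (gaussianPDFReal_nonneg _ _ _), gaussianPDFReal, gaussianPDFReal,
      mul_assoc (Real.sqrt _)⁻¹, ← Real.exp_add]
    congr 3
    field_simp
    ring
  · have e : ∀ x : ℝ, ENNReal.ofReal (Real.exp (((m - m') * x - (m ^ 2 - m' ^ 2) / 2) / v)) ^ a
        = ENNReal.ofReal (Real.exp (-(a * (m ^ 2 - m' ^ 2) / 2 / v)) *
            Real.exp ((a * (m - m') / v) * x)) := by
      intro x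
      rw [ENNReal.ofReal_rpow_of_pos (Real.exp_pos _), ← Real.exp_mul, ← Real.exp_add]
      congr 2
      ring
    simp_rw [e]
    rw [← ofReal_integral_eq_lintegral_ofReal
      ((integrable_exp_mul_gaussianReal _).const_mul _)
      (Filter.Eventually.of_forall fun x => by positivity), integral_const_mul]
    have hm := congrFun (mgf_fun_id_gaussianReal (μ := m') (v := v)) (a * (m - m') / v)
    rw [mgf] at hm
    rw [hm, ← Real.exp_add]
    congr 2
    field_simp
    ring

lemma GapDens.renyi {Ω : Type*} [MeasurableSpace Ω] {a : ℝ} {P Q : Measure Ω}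
    [IsProbabilityMeasure Q] {c : ℝ} (h : GapDens a P Q c) :
    renyiDiv a P Q = (((a - 1)⁻¹ * c : ℝ) : EReal) := by
  obtain ⟨g, hg, rfl, hi⟩ := h
  have e : ∫⁻ x, ((Q.withDensity g).rnDeriv Q x) ^ a ∂Q = ∫⁻ x, g x ^ a ∂Q := by
    refine lintegral_congr_ae ?_
    filter_upwards [Measure.rnDeriv_withDensity Q hg] with x hx
    rw [hx]
  rw [renyiDiv, e, hi, ENNReal.log_ofReal_of_pos (Real.exp_pos _), Real.log_exp, EReal.coe_mul]

lemma gap_gm (I J : Type*) [Fintype I] [Fintype J] (s : ℝ) :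
    ∃ v : ℝ≥0, (v : ℝ) = s ^ 2 ∧ gaussianMatrix I J s =
      Measure.pi fun _ : I => Measure.pi fun _ : J => gaussianReal 0 v :=
  ⟨⟨s ^ 2, sq_nonneg s⟩, rfl, rfl⟩

lemma gap_map (I J : Type*) [Fintype I] [Fintype J] (v : ℝ≥0) (m : I → J → ℝ) :
    Measure.map (fun (N : I → J → ℝ) (i : I) (j : J) => m i j + N i j) 
      (Measure.pi fun _ : I => Measure.pi fun _ : J => gaussianReal 0 v)
      = Measure.pi fun i => Measure.pi fun j => gaussianReal (m i j) v := by
  have h1 : ∀ i j, Measure.map (fun x => m i j + x) (gaussianReal 0 v)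
      = gaussianReal (m i j) v := fun i j => by
    rw [gaussianReal_map_const_add, zero_add]
  have i1 : ∀ i j, IsProbabilityMeasure
      (Measure.map (fun x => m i j + x) (gaussianReal 0 v)) := fun i j => by
    rw [h1]; infer_instance
  have h2 : ∀ i, Measure.map (fun (y : J → ℝ) j => m i j + y j)
      (Measure.pi fun _ => gaussianReal 0 v)
      = Measure.pi fun j => gaussianReal (m i j) v := fun i => by
    rw [Measure.pi_map_pi (f := fun j x => m i j + x) (fun j => by fun_prop)]
    simp_rw [h1]
  have i2 : ∀ i, IsProbabilityMeasure (Measure.map (fun (y : J → ℝ) j => m i j + y j)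
      (Measure.pi fun _ => gaussianReal 0 v)) := fun i => by
    rw [h2]; infer_instance
  have hm : ∀ i, Measurable (fun (y : J → ℝ) j => m i j + y j) := fun i => by
    refine measurable_pi_lambda _ fun j => ?_
    have := measurable_pi_apply (X := fun _ : J => ℝ) j
    exact measurable_const.add this
  rw [Measure.pi_map_pi (f := fun i (y : J → ℝ) j => m i j + y j)
    (fun i => (hm i).aemeasurable)]
  simp_rw [h2]

lemma gap_row {h : ℕ} (a b : ℝ) (ha : a = 0 ∨ a = 1) (hb : b = 0 ∨ b = 1) (x y : Fin h → ℝ)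
    (hx : ∑ j, x j ^ 2 ≤ 1) (hy : ∑ j, y j ^ 2 ≤ 1) :
    ∑ j, (a * x j - b * y j) ^ 2 ≤ 2 * (a + b) := by
  calc ∑ j, (a * x j - b * y j) ^ 2 ≤ ∑ j, (2 * a * x j ^ 2 + 2 * b * y j ^ 2) := by
        refine Finset.sum_le_sum fun j _ => ?_
        rcases ha with rfl | rfl <;> rcases hb with rfl | rfl <;>
          nlinarith [sq_nonneg (x j + y j), sq_nonneg (x j), sq_nonneg (y j)]
    _ = 2 * a * ∑ j, x j ^ 2 + 2 * b * ∑ j, y j ^ 2 := by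
        rw [Finset.sum_add_distrib, Finset.mul_sum, Finset.mul_sum]
    _ ≤ 2 * (a + b) := by
        rcases ha with rfl | rfl <;> rcases hb with rfl | rfl <;> linarith

/-- **One-hop Gaussian-mechanism step in the proof of Theorem 5.1 (GAP).**
With `A, A'` adjacency matrices (zero diagonal, `{0,1}` entries, column sums ≤ `D`) differing
only in row and column `r`, and `H, H'` having rows of ℓ2 norm at most `1` agreeing off row
`r`, the Rényi divergence of order `α` between the laws of `[AH]_{∖r} + N` and
`[A'H']_{∖r} + N'` (independent Gaussian noise of std `s`) is at most `4Dα/(2s²) = 2Dα/s²`. -/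
theorem gap_one_hop_renyi
    (n h D : ℕ) (hh : 1 ≤ h) (r : Fin n) (s α : ℝ) (hs : 0 < s) (hα : 1 < α)
    (A A' : Fin n → Fin n → ℝ)
    (hA01 : ∀ i j, A i j = 0 ∨ A i j = 1)
    (hA'01 : ∀ i j, A' i j = 0 ∨ A' i j = 1)
    (hAdiag : ∀ i, A i i = 0)
    (hA'diag : ∀ i, A' i i = 0)
    (hAdeg : ∀ j, (∑ i, A i j) ≤ (D : ℝ))
    (hA'deg : ∀ j, (∑ i, A' i j) ≤ (D : ℝ))
    (hdiff : ∀ i j, i ≠ r → j ≠ r → A i j = A' i j)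
    (H H' : Fin n → Fin h → ℝ)
    (hH : ∀ i, (∑ j, (H i j) ^ 2) ≤ 1)
    (hH' : ∀ i, (∑ j, (H' i j) ^ 2) ≤ 1)
    (hHr : ∀ i, i ≠ r → H i = H' i) :
    renyiDiv α
      (Measure.map
        (fun N : {i : Fin n // i ≠ r} → Fin h → ℝ =>
          fun (i : {i : Fin n // i ≠ r}) (j : Fin h) => (∑ k, A i.1 k * H k j) + N i j)
        (gaussianMatrix {i : Fin n // i ≠ r} (Fin h) s))
      (Measure.map
        (fun N : {i : Fin n // i ≠ r} → Fin h → ℝ =>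
          fun (i : {i : Fin n // i ≠ r}) (j : Fin h) => (∑ k, A' i.1 k * H' k j) + N i j)
        (gaussianMatrix {i : Fin n // i ≠ r} (Fin h) s))
      ≤ ((2 * D * α / s ^ 2 : ℝ) : EReal) := by
  obtain ⟨v, hcoe, hG⟩ := gap_gm {i : Fin n // i ≠ r} (Fin h) s
  have hv : v ≠ 0 := by
    rintro rfl
    exact (pow_pos hs 2).ne hcoe
  rw [hG]
  rw [gap_map _ _ v (fun (i : {i : Fin n // i ≠ r}) j => ∑ k, A i.1 k * H k j),
    gap_map _ _ v (fun (i : {i : Fin n // i ≠ r}) j => ∑ k, A' i.1 k * H' k j)]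
  have key := GapDens.pi (a := α) (by linarith) _ _ _ fun i : {i : Fin n // i ≠ r} =>
    GapDens.pi (a := α) (by linarith) _ _ _ fun j : Fin h =>
      GapDens.gaussian α (∑ k, A i.1 k * H k j) (∑ k, A' i.1 k * H' k j) v hv
  rw [key.renyi, EReal.coe_le_coe_iff]
  have hrow : ∀ (i : {i : Fin n // i ≠ r}) (j : Fin h),
      (∑ k, A i.1 k * H k j) - (∑ k, A' i.1 k * H' k j)
        = A i.1 r * H r j - A' i.1 r * H' r j := by
    intro i j
    rw [← Finset.sum_sub_distrib]
    refine Finset.sum_eq_single r (fun k _ hk => ?_) (by simp)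
    rw [hdiff i.1 k i.2 hk, hHr k hk, sub_self]
  have hsub : ∀ B : Fin n → Fin n → ℝ, (∀ i j, B i j = 0 ∨ B i j = 1) →
      (∀ j, (∑ i, B i j) ≤ (D : ℝ)) → ∑ i : {i : Fin n // i ≠ r}, B i.1 r ≤ D := by
    intro B hB hD
    refine le_trans ?_ (hD r)
    rw [← Finset.sum_subtype (Finset.univ.filter (· ≠ r)) (by simp) (fun i => B i r)]
    refine Finset.sum_le_sum_of_subset_of_nonneg (Finset.filter_subset _ _) fun i _ _ => ?_
    rcases hB i r with h0 | h0 <;> rw [h0] <;> norm_num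
  have hsum : ∑ i : {i : Fin n // i ≠ r}, ∑ j, (A i.1 r * H r j - A' i.1 r * H' r j) ^ 2
      ≤ 4 * D := by
    calc _ ≤ ∑ i : {i : Fin n // i ≠ r}, 2 * (A i.1 r + A' i.1 r) :=
          Finset.sum_le_sum fun i _ => gap_row _ _ (hA01 _ _) (hA'01 _ _) _ _ (hH r) (hH' r)
      _ ≤ 4 * D := by
          rw [← Finset.mul_sum, Finset.sum_add_distrib]
          linarith [hsub A hA01 hAdeg, hsub A' hA'01 hA'deg]
  simp_rw [hrow, hcoe, ← Finset.sum_div, ← Finset.mul_sum]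
  have h1 : 0 < α - 1 := by linarith
  calc _ = α / (2 * s ^ 2) *
        ∑ i : {i : Fin n // i ≠ r}, ∑ j, (A i.1 r * H r j - A' i.1 r * H' r j) ^ 2 := by
        field_simp
    _ ≤ α / (2 * s ^ 2) * (4 * D) := by gcongr
    _ = _ := by field_simp; ring
end

section
/- (Theorem G.2.) Let n, h, L be natural numbers with h ≥ 1 and L ≥ 1, let s > 0 and α > 1. Let A, A' ∈ {0,1}^{n×n} be adjacency matrices with zero diagonal that differ in exactly one entry. Let H⁽⁰⁾ ∈ ℝ^{n×h} be a fixed (deterministic) matrix each of whose rows has ℓ2 norm at most 1. Define recursively H⁽ˡ⁺¹⁾ = rownorm(A·H⁽ˡ⁾ + N⁽ˡ⁾) for l = 0, …, L−1, where N⁽⁰⁾, …, N⁽ᴸ⁻¹⁾ are mutually independent n×h Gaussian noise matrices with standard deviation s; define H'⁽⁰⁾ = H⁽⁰⁾ and H'⁽ˡ⁺¹⁾ = rownorm(A'·H'⁽ˡ⁾ + N'⁽ˡ⁾) with its own independent noise matrices. Let Z = [H⁽⁰⁾ ‖ H⁽¹⁾ ‖ ⋯ ‖ H⁽ᴸ⁾]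 be the row-wise concatenation and Z' the analogous concatenation. Then D_α(law(Z) ‖ law(Z')) ≤ Lα/(2s²). -/
open MeasureTheory ProbabilityTheory Finset

/-- Row-normalization: the `i`-th row of `M` is replaced by `M_i/‖M_i‖` if `M_i ≠ 0`, and by
the zero vector otherwise. -/
noncomputable def rownorm {n h : ℕ} (M : Fin n → Fin h → ℝ) : Fin n → Fin h → ℝ :=
  fun i j => if M i = 0 then 0 else M i j / Real.sqrt (∑ j', (M i j') ^ 2)

/-- The recursion `H⁽ˡ⁺¹⁾ = rownorm (A·H⁽ˡ⁾ + N⁽ˡ⁾)` of the perturbed aggregation module of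
GAP, starting from `H⁽⁰⁾ = H0` with noise matrices `N 0, N 1, …`. -/
noncomputable def gapIter {n h : ℕ} (A : Fin n → Fin n → ℝ)
    (H0 : Fin n → Fin h → ℝ) (N : ℕ → Fin n → Fin h → ℝ) : ℕ → Fin n → Fin h → ℝ
  | 0 => H0
  | l + 1 => rownorm (fun i j => (∑ kk, A i kk * gapIter A H0 N l kk j) + N l i j)


lemma lintegral_snoc {E : Type*} [MeasurableSpace E] (γ : Measure E) [IsProbabilityMeasure γ]
    (L : ℕ) (φ : (Fin (L + 1) → E) → ENNReal) (hφ : Measurable φ) :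
    ∫⁻ N, φ N ∂(Measure.pi fun _ : Fin (L + 1) => γ)
      = ∫⁻ N0, ∫⁻ y, φ (Fin.snoc (α := fun _ => E) N0 y) ∂γ ∂(Measure.pi fun _ : Fin L => γ) := by
  have h := (measurePreserving_piFinSuccAbove (fun _ : Fin (L + 1) => γ) (Fin.last L)).symm
  rw [← h.lintegral_comp hφ, lintegral_prod_symm]
  · simp only [MeasurableEquiv.piFinSuccAbove_symm_apply, Fin.insertNthEquiv,
      Equiv.coe_fn_mk, Fin.insertNth_last']
  · exact (hφ.comp (MeasurableEquiv.measurable _)).aemeasurable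

lemma measurable_snoc {E : Type*} [MeasurableSpace E] (L : ℕ) :
    Measurable (fun p : (Fin L → E) × E => (Fin.snoc (α := fun _ => E) p.1 p.2 : Fin (L+1) → E)) := by
  rw [measurable_pi_iff]
  intro i
  refine Fin.lastCases ?_ (fun j => ?_) i
  · simpa using measurable_snd
  · simp only [Fin.snoc_castSucc]; fun_prop

/-- restriction -/
def resF {E : Type*} {L : ℕ} (N : Fin L → E) (l : Fin L) : Fin l.val → E :=
  fun i => N ⟨i.val, i.isLt.trans l.isLt⟩

lemma measurable_resF {E : Type*} [MeasurableSpace E] {L : ℕ} (l : Fin L) :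
    Measurable (fun N : Fin L → E => resF N l) := by
  rw [measurable_pi_iff]; intro i; exact measurable_pi_apply _

lemma resF_snoc_castSucc {E : Type*} {L : ℕ} (N : Fin L → E) (y : E) (l : Fin L) :
    resF (Fin.snoc (α := fun _ => E) N y) l.castSucc = resF N l := by
  funext i
  have := i.isLt
  simp only [Fin.val_castSucc] at this
  simp only [resF, Fin.snoc, Fin.castLT]
  rw [dif_pos (show i.val < L from this.trans l.isLt)]
  rfl

lemma resF_snoc_last {E : Type*} {L : ℕ} (N : Fin L → E) (y : E) :
    resF (Fin.snoc (α := fun _ => E) N y) (Fin.last L) = N := by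
  funext i
  have : i.val < L := i.isLt
  simp [resF, Fin.snoc, Fin.castLT, this]

theorem compose {E : Type*} [MeasurableSpace E] (γ : Measure E) [IsProbabilityMeasure γ]
    (a : ℝ) (ha : 0 ≤ a) : ∀ (L : ℕ)
    (T : ∀ l : Fin L, (Fin l.val → E) → E → E)
    (G : ∀ l : Fin L, (Fin l.val → E) → E → ENNReal) (C : Fin L → ENNReal)
    (_ : ∀ l, Measurable (fun p : (Fin l.val → E) × E => T l p.1 p.2))
    (_ : ∀ l, Measurable (fun p : (Fin l.val → E) × E => G l p.1 p.2))
    (_ : ∀ l N (φ : E → ENNReal), Measurable φ →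
      ∫⁻ y, φ (T l N y) * G l N y ∂γ = ∫⁻ y, φ y ∂γ)
    (_ : ∀ l N, ∫⁻ y, (G l N y) ^ a ∂γ ≤ C l),
    (∀ φ : (Fin L → E) → ENNReal, Measurable φ →
      ∫⁻ N, φ (fun l => T l (resF N l) (N l)) * ∏ l, G l (resF N l) (N l)
        ∂(Measure.pi fun _ : Fin L => γ) = ∫⁻ N, φ N ∂(Measure.pi fun _ : Fin L => γ)) ∧
    ∫⁻ N, (∏ l, G l (resF N l) (N l)) ^ a ∂(Measure.pi fun _ : Fin L => γ) ≤ ∏ l, C l := by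
  intro L
  induction L with
  | zero =>
    intro T G C hT hG hφ hC
    refine ⟨fun φ _ => ?_, by simp⟩
    simp only [univ_eq_empty, prod_empty, mul_one]
    congr 1; funext N; congr 1; exact Subsingleton.elim _ _
  | succ L ih =>
    intro T G C hT hG hTG hC
    obtain ⟨ih1, ih2⟩ := ih (fun l => T l.castSucc) (fun l => G l.castSucc) (fun l => C l.castSucc)
      (fun l => hT l.castSucc) (fun l => hG l.castSucc) (fun l => hTG l.castSucc) (fun l => hC l.castSucc)
    have mT : Measurable (fun N : Fin (L+1) → E => fun l => T l (resF N l) (N l)) := by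
      rw [measurable_pi_iff]; intro l
      exact (hT l).comp ((measurable_resF l).prodMk (measurable_pi_apply l))
    have mG : Measurable (fun N : Fin (L+1) → E => ∏ l, G l (resF N l) (N l)) := by
      refine Finset.measurable_prod _ fun l _ => ?_
      exact (hG l).comp ((measurable_resF l).prodMk (measurable_pi_apply l))
    have mG0 : Measurable (fun N : Fin L → E => ∏ l : Fin L, G l.castSucc (resF N l) (N l)) := by
      refine Finset.measurable_prod _ fun l _ => ?_
      exact (hG l.castSucc).comp ((measurable_resF l).prodMk (measurable_pi_apply l))
    have eqT : ∀ (N : Fin L → E) (y : E), (fun l => T l (resF (Fin.snoc (α := fun _ => E) N y) l)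
        ((Fin.snoc (α := fun _ => E) N y : Fin (L+1) → E) l)) =
        Fin.snoc (α := fun _ => E) (fun l : Fin L => T l.castSucc (resF N l) (N l))
          (T (Fin.last L) N y) := by
      intro N y
      funext l
      refine Fin.lastCases ?_ (fun j => ?_) l
      · simp only [Fin.snoc_last, resF_snoc_last]
      · simp only [Fin.snoc_castSucc, resF_snoc_castSucc]
    have eqG : ∀ (N : Fin L → E) (y : E), (∏ l, G l (resF (Fin.snoc (α := fun _ => E) N y) l)
        ((Fin.snoc (α := fun _ => E) N y : Fin (L+1) → E) l)) =
        (∏ l : Fin L, G l.castSucc (resF N l) (N l)) * G (Fin.last L) N y := by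
      intro N y
      rw [Fin.prod_univ_castSucc]
      simp only [Fin.snoc_last, resF_snoc_last, Fin.snoc_castSucc, resF_snoc_castSucc]
    have mGl : ∀ N, Measurable (G (Fin.last L) N) := fun N =>
      (hG (Fin.last L)).comp measurable_prodMk_left
    have mTl : ∀ N, Measurable (T (Fin.last L) N) := fun N =>
      (hT (Fin.last L)).comp measurable_prodMk_left
    constructor
    · intro φ hφ
      have mfull : Measurable (fun N : Fin (L+1) → E => φ (fun l => T l (resF N l) (N l)) *
          ∏ l, G l (resF N l) (N l)) := (hφ.comp mT).mul mG
      rw [lintegral_snoc _ _ _ mfull, lintegral_snoc _ _ _ hφ]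
      simp only [eqT, eqG]
      have hφs := hφ.comp (measurable_snoc (E := E) L)
      have key : ∀ N : Fin L → E, ∫⁻ y, φ (Fin.snoc (α := fun _ => E) (fun l : Fin L => T l.castSucc (resF N l) (N l))
          (T (Fin.last L) N y)) * ((∏ l : Fin L, G l.castSucc (resF N l) (N l)) * G (Fin.last L) N y) ∂γ
          = (∫⁻ y, φ (Fin.snoc (α := fun _ => E) (fun l : Fin L => T l.castSucc (resF N l) (N l)) y) ∂γ) *
            ∏ l : Fin L, G l.castSucc (resF N l) (N l) := by
        intro N
        have m1 : Measurable (fun y => φ (Fin.snoc (α := fun _ => E)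
            (fun l : Fin L => T l.castSucc (resF N l) (N l)) y)) :=
          hφs.comp measurable_prodMk_left
        rw [← hTG (Fin.last L) N _ m1, ← lintegral_mul_const]
        · congr 1; funext y; ring
        · exact (m1.comp (mTl N)).mul (mGl N)
      simp only [key]
      exact ih1 (fun N => ∫⁻ y, φ (Fin.snoc (α := fun _ => E) N y) ∂γ)
        (Measurable.lintegral_prod_right' hφs)
    · rw [lintegral_snoc _ _ _ (mG.pow_const a), Fin.prod_univ_castSucc]
      simp only [eqG, ENNReal.mul_rpow_of_nonneg _ _ ha]
      calc _ ≤ ∫⁻ N, (∏ l : Fin L, G l.castSucc (resF N l) (N l)) ^ a * C (Fin.last L)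
              ∂(Measure.pi fun _ : Fin L => γ) := by
            refine lintegral_mono fun N => ?_
            rw [lintegral_const_mul _ ((mGl N).pow_const a)]
            gcongr
            exact hC _ _
        _ ≤ _ := by
            rw [lintegral_mul_const _ (mG0.pow_const a)]
            gcongr

theorem dataproc {X Y : Type*} [MeasurableSpace X] [MeasurableSpace Y] (γ : Measure X)
    [IsProbabilityMeasure γ] (P : Measure Y) [IsProbabilityMeasure P] (F : X → Y) (hF : Measurable F)
    (D : X → ENNReal) (hD : Measurable D) (a : ℝ) (ha : 1 < a)
    (hP : ∀ φ : Y → ENNReal, Measurable φ → ∫⁻ y, φ y ∂P = ∫⁻ x, φ (F x) * D x ∂γ) :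
    ∫⁻ y, (P.rnDeriv (γ.map F) y) ^ a ∂(γ.map F) ≤ ∫⁻ x, (D x) ^ a ∂γ := by
  set Q := γ.map F with hQ
  have : IsProbabilityMeasure Q := Measure.isProbabilityMeasure_map hF.aemeasurable
  set K := ∫⁻ x, (D x) ^ a ∂γ
  set f := P.rnDeriv Q with hf
  have mf : Measurable f := Measure.measurable_rnDeriv _ _
  have a0 : 0 < a := by linarith
  have main : ∀ M : ℕ, ∫⁻ y, (min (f y) M) ^ a ∂Q ≤ K := by
    intro M
    set I := ∫⁻ y, (min (f y) M) ^ a ∂Q with hI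
    have mfM : Measurable (fun y => min (f y) (M : ENNReal)) := mf.min measurable_const
    have hItop : I ≠ ⊤ := by
      have : I ≤ (M : ENNReal) ^ a := by
        calc I ≤ ∫⁻ y, (M : ENNReal) ^ a ∂Q := by
              refine lintegral_mono fun y => ?_
              exact ENNReal.rpow_le_rpow (min_le_right _ _) a0.le
          _ = _ := by simp
      exact ne_top_of_le_ne_top (ENNReal.rpow_ne_top_of_nonneg a0.le (ENNReal.natCast_ne_top M)) this
    have h1 : I ≤ ∫⁻ y, (min (f y) M) ^ (a - 1) ∂P := by
      calc I ≤ ∫⁻ y, f y * (min (f y) M) ^ (a - 1) ∂Q := by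
            refine lintegral_mono fun y => ?_
            have : (min (f y) (M : ENNReal)) ^ a = min (f y) M * (min (f y) (M : ENNReal)) ^ (a - 1) := by
              nth_rw 2 [← ENNReal.rpow_one (min (f y) (M : ENNReal))]
              rw [← ENNReal.rpow_add_of_nonneg _ _ zero_le_one (by linarith)]
              congr 1; ring
            simp only [this]
            gcongr
            exact min_le_left _ _
        _ = ∫⁻ y, (min (f y) M) ^ (a - 1) ∂(Q.withDensity f) := by
            rw [lintegral_withDensity_eq_lintegral_mul _ mf (mfM.pow_const _)]
            rfl
        _ ≤ _ := lintegral_mono' (Measure.withDensity_rnDeriv_le P Q) le_rfl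
    have hc : (a / (a-1)).HolderConjugate a :=
      (Real.HolderConjugate.conjExponent ha).symm
    have h2 : I ≤ I ^ (1 / (a / (a-1))) * K ^ (1 / a) := by
      refine h1.trans ?_
      rw [hP _ (mfM.pow_const _)]
      refine (ENNReal.lintegral_mul_le_Lp_mul_Lq γ hc
        ((mfM.pow_const (a-1)).comp hF).aemeasurable hD.aemeasurable).trans_eq ?_
      congr 2
      rw [hI, hQ, lintegral_map (mfM.pow_const _) hF]
      congr 1; funext x
      simp only [Function.comp]
      rw [← ENNReal.rpow_mul]
      congr 1
      field_simp [sub_ne_zero.2 ha.ne']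
    by_cases hI0 : I = 0
    · rw [hI0]; exact zero_le
    have h3 : I = I ^ (1 / (a / (a-1))) * I ^ (1/a) := by
      rw [← ENNReal.rpow_add _ _ hI0 hItop]
      have : 1 / (a / (a-1)) + 1 / a = 1 := by
        have := sub_ne_zero.2 ha.ne'
        field_simp; ring
      rw [this, ENNReal.rpow_one]
    have h4 : I ^ (1/a) ≤ K ^ (1/a) := by
      have h2' := h3.symm.le.trans h2
      have hne : I ^ (1 / (a / (a-1))) ≠ 0 := by
        simp [ENNReal.rpow_eq_zero_iff, hI0, hItop]
      have hnt : I ^ (1 / (a / (a-1))) ≠ ⊤ := by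
        simp [ENNReal.rpow_eq_top_iff, hI0, hItop]
      exact (ENNReal.mul_le_mul_iff_right hne hnt).1 h2'
    exact (ENNReal.rpow_le_rpow_iff (by positivity)).1 h4
  have hsup : ∀ y, (f y) ^ a = ⨆ M : ℕ, (min (f y) (M : ENNReal)) ^ a := by
    intro y
    have h1 : f y = ⨆ M : ℕ, min (f y) (M : ENNReal) := by
      have := inf_iSup_eq (f y) (fun M : ℕ => (M : ENNReal))
      rw [ENNReal.iSup_natCast, inf_top_eq] at this
      exact this
    have h2 := (ENNReal.orderIsoRpow a a0).map_iSup (fun M : ℕ => min (f y) (M : ENNReal))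
    rw [← h1] at h2
    simpa only [ENNReal.orderIsoRpow_apply] using h2
  simp only [hsup]
  rw [lintegral_iSup]
  · exact iSup_le main
  · intro M; exact (mf.min measurable_const).pow_const a
  · intro M M' h y
    simp only
    gcongr

/-- variance -/
noncomputable def vv (s : ℝ) : NNReal := ⟨s ^ 2, sq_nonneg s⟩

lemma coe_vv (s : ℝ) : ((vv s : NNReal) : ℝ) = s ^ 2 := rfl

noncomputable def gdens (v d y : ℝ) : ENNReal := ENNReal.ofReal (Real.exp (d * y / v - d ^ 2 / (2 * v)))

lemma measurable_gdens (v : ℝ) : Measurable (fun p : ℝ × ℝ => gdens v p.1 p.2) := by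
  unfold gdens; fun_prop

lemma gauss1_shift (s : ℝ) (hs : 0 < s) (d : ℝ) (φ : ℝ → ENNReal) (hφ : Measurable φ) :
    ∫⁻ y, φ (y - d) * gdens (s ^ 2) d y ∂(gaussianReal 0 (vv s))
      = ∫⁻ y, φ y ∂(gaussianReal 0 (vv s)) := by
  have hv : vv s ≠ 0 := by
    intro h
    have := congrArg NNReal.toReal h
    simp only [coe_vv, NNReal.coe_zero] at this
    exact (pow_pos hs 2).ne' this
  have mg : Measurable (gdens (s ^ 2) d) := (measurable_gdens (s^2)).comp measurable_prodMk_left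
  rw [gaussianReal_of_var_ne_zero _ hv, lintegral_withDensity_eq_lintegral_mul _ (by fun_prop) (by fun_prop),
    lintegral_withDensity_eq_lintegral_mul _ (by fun_prop) hφ]
  rw [← lintegral_sub_right_eq_self (fun y => (gaussianPDF 0 (vv s) * φ) y) d]
  congr 1; funext y
  simp only [Pi.mul_apply]
  rw [mul_left_comm, mul_comm (gaussianPDF _ _ (y - d))]
  congr 1
  simp only [gdens, gaussianPDF, gaussianPDFReal]
  rw [← ENNReal.ofReal_mul (by positivity), mul_assoc, ← Real.exp_add]
  simp only [coe_vv]
  congr 3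
  field_simp
  ring

lemma gauss1_pow (s : ℝ) (hs : 0 < s) (d a : ℝ) :
    ∫⁻ y, (gdens (s ^ 2) d y) ^ a ∂(gaussianReal 0 (vv s))
      ≤ ENNReal.ofReal (Real.exp (a * (a - 1) / (2 * s ^ 2) * d ^ 2)) := by
  have h := mgf_id_gaussianReal (μ := 0) (v := vv s)
  have h := congrFun h (a * d / s ^ 2)
  simp only [mgf, id] at h
  have hi := integrable_exp_mul_gaussianReal (μ := 0) (v := vv s) (a * d / s ^ 2)
  have e : ∀ y, (gdens (s ^ 2) d y) ^ a = ENNReal.ofReal (Real.exp (- a * d ^ 2 / (2 * s ^ 2))) *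
      ENNReal.ofReal (Real.exp (a * d / s ^ 2 * y)) := by
    intro y
    rw [gdens, ENNReal.ofReal_rpow_of_pos (Real.exp_pos _), ← Real.exp_mul,
      ← ENNReal.ofReal_mul (by positivity), ← Real.exp_add]
    congr 2
    field_simp
    ring
  simp only [e]
  rw [lintegral_const_mul _ (by fun_prop), ← ofReal_integral_eq_lintegral_ofReal hi
    (Filter.Eventually.of_forall fun _ => (Real.exp_pos _).le), h,
    ← ENNReal.ofReal_mul (by positivity), ← Real.exp_add]
  apply le_of_eq
  congr 2
  simp only [coe_vv]
  field_simp
  ring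

lemma prod_ofReal_exp {ι : Type*} [Fintype ι] (c : ι → ℝ) :
    ∏ i, ENNReal.ofReal (Real.exp (c i)) = ENNReal.ofReal (Real.exp (∑ i, c i)) := by
  rw [Real.exp_sum, ENNReal.ofReal_prod_of_nonneg (fun _ _ => (Real.exp_pos _).le)]

lemma gaussRow (h : ℕ) (s a : ℝ) (hs : 0 < s) (ha : 0 ≤ a) (d : Fin h → ℝ) :
    (∀ φ : (Fin h → ℝ) → ENNReal, Measurable φ →
      ∫⁻ N, φ (N - d) * ∏ l, gdens (s ^ 2) (d l) (N l)
        ∂(Measure.pi fun _ : Fin h => gaussianReal 0 (vv s))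
        = ∫⁻ N, φ N ∂(Measure.pi fun _ : Fin h => gaussianReal 0 (vv s))) ∧
    ∫⁻ N, (∏ l, gdens (s ^ 2) (d l) (N l)) ^ a
      ∂(Measure.pi fun _ : Fin h => gaussianReal 0 (vv s))
      ≤ ENNReal.ofReal (Real.exp (a * (a - 1) / (2 * s ^ 2) * ∑ l, d l ^ 2)) := by
  have := compose (gaussianReal 0 (vv s)) a ha h (fun l _ y => y - d l)
    (fun l _ y => gdens (s ^ 2) (d l) y)
    (fun l => ENNReal.ofReal (Real.exp (a * (a - 1) / (2 * s ^ 2) * d l ^ 2)))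
    (fun l => by fun_prop)
    (fun l => (measurable_gdens (s^2)).comp (measurable_const.prodMk measurable_snd))
    (fun l _ φ hφ => gauss1_shift s hs (d l) φ hφ) (fun l _ => gauss1_pow s hs (d l) a)
  rw [prod_ofReal_exp, ← Finset.mul_sum] at this
  exact this

noncomputable def mdens {n h : ℕ} (v : ℝ) (d y : Fin n → Fin h → ℝ) : ENNReal :=
  ∏ i, ∏ j, gdens v (d i j) (y i j)

lemma measurable_mdens {n h : ℕ} (v : ℝ) :
    Measurable (fun p : (Fin n → Fin h → ℝ) × (Fin n → Fin h → ℝ) => mdens v p.1 p.2) := by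
  unfold mdens
  refine Finset.measurable_prod _ fun i _ => Finset.measurable_prod _ fun j _ => ?_
  exact (measurable_gdens v).comp (by fun_prop : Measurable fun p : (Fin n → Fin h → ℝ) × (Fin n → Fin h → ℝ) => (p.1 i j, p.2 i j))

lemma measurable_mdens_comp {X : Type*} [MeasurableSpace X] {n h : ℕ} (v : ℝ)
    {f g : X → Fin n → Fin h → ℝ} (hf : Measurable f) (hg : Measurable g) :
    Measurable (fun x => mdens v (f x) (g x)) := by
  unfold mdens
  refine Finset.measurable_prod _ fun i _ => Finset.measurable_prod _ fun j _ => ?_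
  unfold gdens
  fun_prop

instance (n h : ℕ) (s : ℝ) : IsProbabilityMeasure (gaussianMatrix (Fin n) (Fin h) s) := by
  change IsProbabilityMeasure (Measure.pi fun _ : Fin n => Measure.pi fun _ : Fin h =>
    gaussianReal 0 (vv s))
  infer_instance

lemma gaussMat (n h : ℕ) (s a : ℝ) (hs : 0 < s) (ha : 0 ≤ a) (d : Fin n → Fin h → ℝ) :
    (∀ φ : (Fin n → Fin h → ℝ) → ENNReal, Measurable φ →
      ∫⁻ N, φ (N - d) * mdens (s ^ 2) d N ∂(gaussianMatrix (Fin n) (Fin h) s)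
        = ∫⁻ N, φ N ∂(gaussianMatrix (Fin n) (Fin h) s)) ∧
    ∫⁻ N, (mdens (s ^ 2) d N) ^ a ∂(gaussianMatrix (Fin n) (Fin h) s)
      ≤ ENNReal.ofReal (Real.exp (a * (a - 1) / (2 * s ^ 2) * ∑ i, ∑ j, d i j ^ 2)) := by
  have := compose (Measure.pi fun _ : Fin h => gaussianReal 0 (vv s)) a ha n
    (fun l _ y => y - d l)
    (fun l _ y => ∏ j, gdens (s ^ 2) (d l j) (y j))
    (fun l => ENNReal.ofReal (Real.exp (a * (a - 1) / (2 * s ^ 2) * ∑ j, d l j ^ 2)))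
    (fun l => by fun_prop)
    (fun l => Finset.measurable_prod _ fun j _ =>
      (measurable_gdens (s^2)).comp (measurable_const.prodMk (by fun_prop)))
    (fun l _ φ hφ => (gaussRow h s a hs ha (d l)).1 φ hφ)
    (fun l _ => (gaussRow h s a hs ha (d l)).2)
  rw [prod_ofReal_exp, ← Finset.mul_sum] at this
  exact this

lemma measurable_rownorm {n h : ℕ} : Measurable (rownorm (n := n) (h := h)) := by
  rw [measurable_pi_iff]; intro i
  rw [measurable_pi_iff]; intro j
  unfold rownorm
  refine Measurable.ite ?_ measurable_const (by fun_prop)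
  exact (measurable_pi_apply i) (measurableSet_singleton 0)

lemma rownorm_row {n h : ℕ} (M : Fin n → Fin h → ℝ) (i : Fin n) : ∑ j, (rownorm M i j) ^ 2 ≤ 1 := by
  unfold rownorm
  split_ifs with h0
  · simp
  · simp only [div_pow]
    rw [← Finset.sum_div, Real.sq_sqrt (Finset.sum_nonneg fun _ _ => sq_nonneg _)]
    exact div_self_le_one _

lemma gapIter_row {n h : ℕ} (A : Fin n → Fin n → ℝ) (H0 : Fin n → Fin h → ℝ)
    (hH0 : ∀ i, (∑ j, (H0 i j) ^ 2) ≤ 1) (N : ℕ → Fin n → Fin h → ℝ) (l : ℕ) (i : Fin n) :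
    ∑ j, (gapIter A H0 N l i j) ^ 2 ≤ 1 := by
  cases l with
  | zero => exact hH0 i
  | succ l => exact rownorm_row _ i

/-- extension by zero -/
noncomputable def extN {E : Type*} [Zero E] {L : ℕ} (N : Fin L → E) : ℕ → E :=
  fun l => if hl : l < L then N ⟨l, hl⟩ else 0

lemma measurable_extN {E : Type*} [MeasurableSpace E] [Zero E] {L : ℕ} (l : ℕ) :
    Measurable (fun N : Fin L → E => extN N l) := by
  unfold extN
  split_ifs <;> fun_prop

lemma measurable_gapIter {n h L : ℕ} (A : Fin n → Fin n → ℝ) (H0 : Fin n → Fin h → ℝ) (l : ℕ) :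
    Measurable (fun N : Fin L → Fin n → Fin h → ℝ => gapIter A H0 (extN N) l) := by
  induction l with
  | zero => exact measurable_const
  | succ l ih =>
    simp only [gapIter]
    refine measurable_rownorm.comp ?_
    have := measurable_extN (E := Fin n → Fin h → ℝ) (L := L) l
    fun_prop

lemma gapIter_congr {n h : ℕ} (A : Fin n → Fin n → ℝ) (H0 : Fin n → Fin h → ℝ)
    (N N' : ℕ → Fin n → Fin h → ℝ) (l : ℕ) (hN : ∀ k < l, N k = N' k) :
    gapIter A H0 N l = gapIter A H0 N' l := by
  induction l with
  | zero => rfl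
  | succ l ih =>
    simp only [gapIter]
    rw [ih (fun k hk => hN k (hk.trans (Nat.lt_succ_self l))), hN l (Nat.lt_succ_self l)]

/-- drift -/
noncomputable def drift {n h : ℕ} (A A' : Fin n → Fin n → ℝ) (H : Fin n → Fin h → ℝ) :
    Fin n → Fin h → ℝ := fun i j => ∑ k, (A i k - A' i k) * H k j

lemma measurable_drift {n h : ℕ} (A A' : Fin n → Fin n → ℝ) :
    Measurable (drift (h := h) A A') := by
  unfold drift; fun_prop

lemma drift_le {n h : ℕ} (A A' : Fin n → Fin n → ℝ)
    (hA01 : ∀ i j, A i j = 0 ∨ A i j = 1)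
    (hA'01 : ∀ i j, A' i j = 0 ∨ A' i j = 1)
    (hdiff : ∃! p : Fin n × Fin n, A p.1 p.2 ≠ A' p.1 p.2)
    (H : Fin n → Fin h → ℝ) (hH : ∀ i, ∑ j, (H i j) ^ 2 ≤ 1) :
    ∑ i, ∑ j, (drift A A' H i j) ^ 2 ≤ 1 := by
  obtain ⟨⟨p, q⟩, hpq, huniq⟩ := hdiff
  have hz : ∀ i k, (i, k) ≠ (p, q) → A i k - A' i k = 0 := by
    intro i k hne
    by_contra hc
    exact hne (huniq (i, k) (sub_ne_zero.1 hc))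
  have hrow : ∀ i, i ≠ p → ∑ j, (drift A A' H i j) ^ 2 = 0 := by
    intro i hi
    refine Finset.sum_eq_zero fun j _ => ?_
    have : drift A A' H i j = 0 := by
      refine Finset.sum_eq_zero fun k _ => ?_
      rw [hz i k (by simp [hi]), zero_mul]
    rw [this]; simp
  rw [Finset.sum_eq_single p (fun i _ hi => hrow i hi) (by simp)]
  have hd : ∀ j, drift A A' H p j = (A p q - A' p q) * H q j := by
    intro j
    refine Finset.sum_eq_single q (fun k _ hk => ?_) (by simp)
    rw [hz p k (by simp [hk]), zero_mul]
  have hsq : (A p q - A' p q) ^ 2 ≤ 1 := by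
    rcases hA01 p q with h1 | h1 <;> rcases hA'01 p q with h2 | h2 <;> rw [h1, h2] <;> norm_num
  simp only [hd, mul_pow]
  rw [← Finset.mul_sum]
  have h0 : 0 ≤ ∑ j, H q j ^ 2 := Finset.sum_nonneg fun _ _ => sq_nonneg _
  nlinarith [hH q]

/-- The predictable drift at step `l`. -/
noncomputable def pdrift {n h L : ℕ} (A A' : Fin n → Fin n → ℝ) (H0 : Fin n → Fin h → ℝ)
    (l : Fin L) (N : Fin l.val → Fin n → Fin h → ℝ) : Fin n → Fin h → ℝ :=
  drift A A' (gapIter A' H0 (extN N) l.val)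

theorem gap_power_bound
    (n h L : ℕ) (s α : ℝ) (hs : 0 < s) (hα : 1 < α)
    (A A' : Fin n → Fin n → ℝ)
    (hA01 : ∀ i j, A i j = 0 ∨ A i j = 1)
    (hA'01 : ∀ i j, A' i j = 0 ∨ A' i j = 1)
    (hdiff : ∃! p : Fin n × Fin n, A p.1 p.2 ≠ A' p.1 p.2)
    (H0 : Fin n → Fin h → ℝ)
    (hH0 : ∀ i, (∑ j, (H0 i j) ^ 2) ≤ 1)
    (Γ : Measure (Fin L → Fin n → Fin h → ℝ))
    (hΓ : Γ = Measure.pi fun _ : Fin L => gaussianMatrix (Fin n) (Fin h) s) :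
    ∫⁻ y, ((Γ.map (fun Ns : Fin L → Fin n → Fin h → ℝ =>
          fun (i : Fin n) (p : Fin (L + 1) × Fin h) => gapIter A H0 (extN Ns) p.1 i p.2)).rnDeriv
        (Γ.map (fun Ns : Fin L → Fin n → Fin h → ℝ =>
          fun (i : Fin n) (p : Fin (L + 1) × Fin h) => gapIter A' H0 (extN Ns) p.1 i p.2)) y) ^ α
        ∂(Γ.map (fun Ns : Fin L → Fin n → Fin h → ℝ =>
          fun (i : Fin n) (p : Fin (L + 1) × Fin h) => gapIter A' H0 (extN Ns) p.1 i p.2))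
      ≤ ENNReal.ofReal (Real.exp (∑ _l : Fin L, α * (α - 1) / (2 * s ^ 2))) := by
  have : IsProbabilityMeasure Γ := by rw [hΓ]; infer_instance
  have mF : ∀ B : Fin n → Fin n → ℝ, Measurable (fun Ns : Fin L → Fin n → Fin h → ℝ =>
          fun (i : Fin n) (p : Fin (L + 1) × Fin h) => gapIter B H0 (extN Ns) p.1 i p.2) := by
    intro B
    rw [measurable_pi_iff]; intro i
    rw [measurable_pi_iff]; intro p
    have := measurable_gapIter (L := L) B H0 p.1
    fun_prop
  -- the predictable drift
  obtain ⟨δ, hδ⟩ : ∃ δ : ∀ l : Fin L, (Fin l.val → Fin n → Fin h → ℝ) → Fin n → Fin h → ℝ,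
    δ = fun l N => pdrift A A' H0 l N := ⟨_, rfl⟩
  have mδ : ∀ l, Measurable (δ l) := fun l => by
    rw [hδ]; exact (measurable_drift A A').comp (measurable_gapIter A' H0 l.val)
  have a0 : 0 ≤ α := by linarith
  have p1 : ∀ l : Fin L, Measurable (fun p : (Fin l.val → Fin n → Fin h → ℝ) ×
      (Fin n → Fin h → ℝ) => p.2 - δ l p.1) := fun l =>
    measurable_snd.sub ((mδ l).comp measurable_fst)
  have p2 : ∀ l : Fin L, Measurable (fun p : (Fin l.val → Fin n → Fin h → ℝ) ×
      (Fin n → Fin h → ℝ) => mdens (s ^ 2) (δ l p.1) p.2) := fun l =>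
    measurable_mdens_comp (s^2) ((mδ l).comp measurable_fst) measurable_snd
  have p3 : ∀ (l : Fin L) (N : Fin l.val → Fin n → Fin h → ℝ)
      (φ : (Fin n → Fin h → ℝ) → ENNReal), Measurable φ →
      ∫⁻ y, φ (y - δ l N) * mdens (s ^ 2) (δ l N) y ∂(gaussianMatrix (Fin n) (Fin h) s)
        = ∫⁻ y, φ y ∂(gaussianMatrix (Fin n) (Fin h) s) :=
    fun l N φ hφ => (gaussMat n h s α hs a0 (δ l N)).1 φ hφ
  have p4 : ∀ (l : Fin L) (N : Fin l.val → Fin n → Fin h → ℝ),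
      ∫⁻ y, (mdens (s ^ 2) (δ l N) y) ^ α ∂(gaussianMatrix (Fin n) (Fin h) s)
        ≤ ENNReal.ofReal (Real.exp (α * (α - 1) / (2 * s ^ 2))) := by
    intro l N
    refine ((gaussMat n h s α hs a0 (δ l N)).2).trans ?_
    apply ENNReal.ofReal_le_ofReal
    apply Real.exp_le_exp.2
    have h1 : ∑ i, ∑ j, (δ l N i j) ^ 2 ≤ 1 := by
      rw [hδ]
      exact drift_le A A' hA01 hA'01 hdiff _ (gapIter_row A' H0 hH0 (extN N) l.val)
    refine mul_le_of_le_one_right ?_ h1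
    have : 0 < α - 1 := by linarith
    positivity
  obtain ⟨c1, c2⟩ := compose (gaussianMatrix (Fin n) (Fin h) s) α a0 L
    (fun l N y => y - δ l N) (fun l N y => mdens (s ^ 2) (δ l N) y)
    (fun _ => ENNReal.ofReal (Real.exp (α * (α - 1) / (2 * s ^ 2)))) p1 p2 p3 p4
  rw [prod_ofReal_exp, ← hΓ] at c2
  rw [← hΓ] at c1
  -- coupling
  have coup : ∀ N : Fin L → Fin n → Fin h → ℝ, ∀ l : ℕ, l ≤ L →
      gapIter A H0 (extN (fun l => N l - δ l (resF N l))) l = gapIter A' H0 (extN N) l := by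
    intro N l
    induction l with
    | zero => intro _; rfl
    | succ l ih =>
      intro hl
      simp only [gapIter]
      rw [ih (by omega)]
      congr 1
      funext i j
      have hl' : l < L := by omega
      have e1 : extN (fun l => N l - δ l (resF N l)) l = N ⟨l, hl'⟩ - δ ⟨l, hl'⟩ (resF N ⟨l, hl'⟩) := by
        simp only [extN, dif_pos hl']
      have e2 : extN N l = N ⟨l, hl'⟩ := by simp only [extN, dif_pos hl']
      have e3 : gapIter A' H0 (extN (resF N ⟨l, hl'⟩)) l = gapIter A' H0 (extN N) l := by
        apply gapIter_congr
        intro k hk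
        have hk' : k < L := by omega
        simp only [extN, resF, dif_pos hk, dif_pos hk']
      rw [e1, e2]
      simp only [hδ, pdrift, e3, Pi.sub_apply, drift, sub_mul, Finset.sum_sub_distrib]
      ring
  have : IsProbabilityMeasure (Γ.map (fun Ns : Fin L → Fin n → Fin h → ℝ =>
          fun (i : Fin n) (p : Fin (L + 1) × Fin h) => gapIter A H0 (extN Ns) p.1 i p.2)) :=
    Measure.isProbabilityMeasure_map (mF A).aemeasurable
  have dp := dataproc Γ (Γ.map (fun Ns : Fin L → Fin n → Fin h → ℝ =>
          fun (i : Fin n) (p : Fin (L + 1) × Fin h) => gapIter A H0 (extN Ns) p.1 i p.2))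
    _ (mF A') (fun N => ∏ l, mdens (s ^ 2) (δ l (resF N l)) (N l))
    (Finset.measurable_prod _ fun l _ => measurable_mdens_comp (s^2)
      ((mδ l).comp (measurable_resF l)) (measurable_pi_apply l)) α hα
    (by
      intro φ hφ
      rw [lintegral_map hφ (mF A)]
      refine (c1 _ (hφ.comp (mF A))).symm.trans ?_
      congr 1; funext N
      congr 1
      simp only [Function.comp]
      congr 1
      funext i p
      rw [coup N p.1 (by have := p.1.isLt; omega)])
  exact dp.trans c2

/-- **Theorem G.2 (GAP, edge-level adjacency).**
`A, A'` are adjacency matrices (zero diagonal, `{0,1}` entries) differing in exactly one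
entry, and `H⁽⁰⁾` is a fixed matrix all of whose rows have ℓ2 norm at most `1`.  With
`H⁽ˡ⁺¹⁾ = rownorm(A·H⁽ˡ⁾ + N⁽ˡ⁾)` for mutually independent Gaussian noise matrices of std
`s` (and analogously for `A'` with its own noise), and `Z = [H⁽⁰⁾ ‖ ⋯ ‖ H⁽ᴸ⁾]`,
`Z' = [H'⁽⁰⁾ ‖ ⋯ ‖ H'⁽ᴸ⁾]`, we have `D_α(law(Z) ‖ law(Z')) ≤ Lα/(2s²)`. -/
theorem gap_edge_gdp
    (n h L : ℕ) (hh : 1 ≤ h) (hL : 1 ≤ L) (s α : ℝ) (hs : 0 < s) (hα : 1 < α)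
    (A A' : Fin n → Fin n → ℝ)
    (hA01 : ∀ i j, A i j = 0 ∨ A i j = 1)
    (hA'01 : ∀ i j, A' i j = 0 ∨ A' i j = 1)
    (hAdiag : ∀ i, A i i = 0)
    (hA'diag : ∀ i, A' i i = 0)
    (hdiff : ∃! p : Fin n × Fin n, A p.1 p.2 ≠ A' p.1 p.2)
    (H0 : Fin n → Fin h → ℝ)
    (hH0 : ∀ i, (∑ j, (H0 i j) ^ 2) ≤ 1) :
    renyiDiv α
      (Measure.map
        (fun Ns : Fin L → Fin n → Fin h → ℝ =>
          fun (i : Fin n) (p : Fin (L + 1) × Fin h) =>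
            gapIter A H0 (fun l => if hl : l < L then Ns ⟨l, hl⟩ else 0) p.1 i p.2)
        (Measure.pi fun _ : Fin L => gaussianMatrix (Fin n) (Fin h) s))
      (Measure.map
        (fun Ns : Fin L → Fin n → Fin h → ℝ =>
          fun (i : Fin n) (p : Fin (L + 1) × Fin h) =>
            gapIter A' H0 (fun l => if hl : l < L then Ns ⟨l, hl⟩ else 0) p.1 i p.2)
        (Measure.pi fun _ : Fin L => gaussianMatrix (Fin n) (Fin h) s))
      ≤ ((L * α / (2 * s ^ 2) : ℝ) : EReal) := by
  have fin := gap_power_bound n h L s α hs hα A A' hA01 hA'01 hdiff H0 hH0 _ rfl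
  unfold renyiDiv
  have hlog := ENNReal.log_le_log fin
  rw [ENNReal.log_ofReal_of_pos (Real.exp_pos _), Real.log_exp] at hlog
  have h1 : 0 < α - 1 := by linarith
  refine (mul_le_mul_of_nonneg_left hlog (by exact_mod_cast (inv_pos.2 h1).le)).trans ?_
  rw [← EReal.coe_mul]
  apply le_of_eq
  congr 1
  simp only [Finset.sum_const, Finset.card_univ, Fintype.card_fin, nsmul_eq_mul]
  field_simp
end
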